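/- arXiv:1606.07560 — 10 statements merged into one kernel-verified Lean document; each statement's English description precedes it below -/
import Mathlib

section
/- Let S_i and S_j be n×n real symmetric positive definite matrices and define the deluxe scaling matrices D_i = (S_i+S_j)⁻¹ S_i and D_j = (S_i+S_j)⁻¹ S_j. Then D_jᵀ S_i D_j + D_iᵀ S_j D_i = S_i (S_i+S_j)⁻¹ S_j, which is the parallel sum S_i : S_j. (Hence the generalized eigenvalue problem (D_jᵀ S_i D_j + D_iᵀ S_j D_i) v = λ (S̃_i : S̃_j) v with deluxe scalings has left-hand matrix equal to the parallel sum S_i : S_j.) -/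
open Matrix

/-- Let `Si` and `Sj` be `n × n` real symmetric positive definite matrices
and define the deluxe scaling matrices `Di = (Si + Sj)⁻¹ Si` and `Dj = (Si + Sj)⁻¹ Sj`.
Then `Djᵀ Si Dj + Diᵀ Sj Di = Si (Si + Sj)⁻¹ Sj`, which is the parallel sum
`Si : Sj = Sj (Si + Sj)⁻¹ Si`. -/
theorem deluxe_scaling_parallel_sum {n : ℕ} (Si Sj : Matrix (Fin n) (Fin n) ℝ)
    (hSi : Si.PosDef) (hSj : Sj.PosDef) :
    ((Si + Sj)⁻¹ * Sj)ᵀ * Si * ((Si + Sj)⁻¹ * Sj) +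
      ((Si + Sj)⁻¹ * Si)ᵀ * Sj * ((Si + Sj)⁻¹ * Si) = Si * (Si + Sj)⁻¹ * Sj ∧
    Si * (Si + Sj)⁻¹ * Sj = Sj * (Si + Sj)⁻¹ * Si := by
  have hU : IsUnit (Si + Sj).det := (Matrix.isUnit_iff_isUnit_det _).1 (hSi.add hSj).isUnit
  have h1 : (Si + Sj)⁻¹ * (Si + Sj) = 1 := Matrix.nonsing_inv_mul _ hU
  have h2 : (Si + Sj) * (Si + Sj)⁻¹ = 1 := Matrix.mul_nonsing_inv _ hU
  have tA : Siᵀ = Si := by simpa using hSi.isHermitian.eq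
  have tB : Sjᵀ = Sj := by simpa using hSj.isHermitian.eq
  have tM : ((Si + Sj)⁻¹)ᵀ = (Si + Sj)⁻¹ := by
    rw [Matrix.transpose_nonsing_inv, Matrix.transpose_add, tA, tB]
  rw [Matrix.transpose_mul, Matrix.transpose_mul, tM, tA, tB]
  generalize (Si + Sj)⁻¹ = M at *
  have hP : Si * M * Sj = Sj * M * Si := by
    have e1 : Si * M * Sj + Si * M * Si = Si := by
      rw [← Matrix.mul_add, add_comm Sj Si, Matrix.mul_assoc, h1, Matrix.mul_one]
    have e2 : Sj * M * Si + Si * M * Si = Si := by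
      rw [← Matrix.add_mul, ← Matrix.add_mul, add_comm Sj Si, h2, Matrix.one_mul]
    exact add_right_cancel (e1.trans e2.symm)
  refine ⟨?_, hP⟩
  rw [← hP, ← Matrix.mul_add, ← Matrix.mul_add, add_comm Sj Si, h1, Matrix.mul_one]
end

section
/- Let A be an n×n real symmetric positive definite matrix, T an n×n real symmetric positive semidefinite matrix, and suppose v_1, …, v_n ∈ ℝ^n and μ_1, …, μ_n ≥ 0 satisfy ⟨A v_l, v_m⟩ = δ_{lm} (A-orthonormality) and T v_l = μ_l A v_l for all l (generalized eigenpairs of the pencil A v = λ T v, with λ_l = 1/μ_l). Let τ > 0 and let s ⊆ {1,…,n} be a set of selected indices such that τ·μ_l ≥ 1 for every l ∉ s. Then for every w ∈ ℝ^n, setting Π w := Σ_{l ∈ s} ⟨A w, v_l⟩ v_l, one has ⟨A(w − Πw), w − Πw⟩ ≤ τ ⟨T w, w⟩. -/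
open Matrix Finset

/-- Let `A` be an `n × n` real symmetric positive definite matrix, `T` an
`n × n` real symmetric positive semidefinite matrix, and suppose `v 1, …, v n ∈ ℝ^n` and
`μ 1, …, μ n ≥ 0` satisfy `⟨A (v l), v m⟩ = δ_{lm}` (A-orthonormality) and
`T (v l) = μ l • A (v l)` for all `l` (generalized eigenpairs of the pencil `A v = λ T v`
with `λ l = 1 / μ l`). Let `τ > 0` and let `s ⊆ {1, …, n}` be a set of selected indices
such that `τ * μ l ≥ 1` for every `l ∉ s`. Then for every `w ∈ ℝ^n`, setting
`Π w := ∑ l ∈ s, ⟨A w, v l⟩ • v l`, one has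
`⟨A (w - Π w), w - Π w⟩ ≤ τ * ⟨T w, w⟩`. -/
theorem adaptive_eigenvector_selection_bound {n : ℕ}
    (A T : Matrix (Fin n) (Fin n) ℝ) (hA : A.PosDef) (hT : T.PosSemidef)
    (v : Fin n → Fin n → ℝ) (μ : Fin n → ℝ) (hμ : ∀ l, 0 ≤ μ l)
    (horth : ∀ l m, (A *ᵥ v l) ⬝ᵥ v m = if l = m then 1 else 0)
    (heig : ∀ l, T *ᵥ v l = μ l • (A *ᵥ v l))
    (τ : ℝ) (hτ : 0 < τ) (s : Finset (Fin n)) (hs : ∀ l ∉ s, 1 ≤ τ * μ l)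
    (w : Fin n → ℝ) :
    (A *ᵥ (w - ∑ l ∈ s, ((A *ᵥ w) ⬝ᵥ v l) • v l)) ⬝ᵥ
        (w - ∑ l ∈ s, ((A *ᵥ w) ⬝ᵥ v l) • v l) ≤
      τ * ((T *ᵥ w) ⬝ᵥ w) := by
  have hsum : ∀ (c : Fin n → ℝ) (m : Fin n), (A *ᵥ (∑ l, c l • v l)) ⬝ᵥ v m = c m := by
    intro c m
    simp [Matrix.mulVec_sum, Matrix.mulVec_smul, sum_dotProduct, smul_dotProduct, horth]
  have hTsum : ∀ (c : Fin n → ℝ) (m : Fin n),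
      (T *ᵥ (∑ l, c l • v l)) ⬝ᵥ v m = μ m * c m := by
    intro c m
    simp [Matrix.mulVec_sum, Matrix.mulVec_smul, sum_dotProduct, smul_dotProduct, horth, heig,
      mul_comm]
  have hli : LinearIndependent ℝ v := by
    rw [Fintype.linearIndependent_iff]
    intro g hg i
    rw [← hsum g i, hg]
    simp
  have hspan : Submodule.span ℝ (Set.range v) = ⊤ :=
    hli.span_eq_top_of_card_eq_finrank' (by simp)
  have hw : w ∈ Submodule.span ℝ (Set.range v) := by rw [hspan]; trivial
  obtain ⟨c, rfl⟩ := (Submodule.mem_span_range_iff_exists_fun ℝ).1 hw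
  have hproj : (∑ l, c l • v l) - ∑ l ∈ s, ((A *ᵥ (∑ l, c l • v l)) ⬝ᵥ v l) • v l
      = ∑ l, (if l ∈ s then 0 else c l) • v l := by
    simp only [hsum]
    have h : ∑ l ∈ s, c l • v l = ∑ l, (if l ∈ s then c l else 0) • v l := by
      simp [ite_smul, Finset.sum_ite_mem]
    rw [h, ← Finset.sum_sub_distrib]
    refine Finset.sum_congr rfl fun l _ => ?_
    by_cases hl : l ∈ s <;> simp [hl]
  rw [hproj, dotProduct_sum, dotProduct_sum, Finset.mul_sum]
  refine Finset.sum_le_sum fun l _ => ?_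
  rw [dotProduct_smul, dotProduct_smul, hsum, hTsum, smul_eq_mul, smul_eq_mul]
  by_cases hl : l ∈ s
  · have := mul_nonneg (mul_nonneg hτ.le (hμ l)) (mul_self_nonneg (c l))
    simp only [hl, if_true]
    linarith
  · have := mul_le_mul_of_nonneg_right (hs l hl) (mul_self_nonneg (c l))
    simp only [hl, if_false]
    linarith
end

section
/- (Lemma on the face bound.) Let n_F, n_i, n_j be positive integers. Let S^(i) be an (n_F+n_i)×(n_F+n_i) real symmetric positive definite matrix written in 2×2 block form with respect to ℝ^{n_F} ⊕ ℝ^{n_i}, with (1,1)-block S_F^(i), and similarly let S^(j) be symmetric positive definite over ℝ^{n_F} ⊕ ℝ^{n_j} with (1,1)-block S_F^(j). Let S̃_F^(i) and S̃_F^(j) be the Schur complements of S^(i) and S^(j) eliminating the second block (these are symmetric positive definite). Let D_F^(i), D_F^(j) be arbitrary n_F×n_F real matrices, set A_F = (D_F^(j))ᵀ S_F^(i) D_F^(j) + (D_F^(i))ᵀ S_F^(j) D_F^(i), assume A_F is positive definite, and set T = ((S̃_F^(i))⁻¹ + (S̃_F^(j))⁻¹)⁻¹, the parallel sum S̃_F^(i)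 : S̃_F^(j). Suppose v_1,…,v_{n_F} ∈ ℝ^{n_F} and μ_1,…,μ_{n_F} ≥ 0 satisfy ⟨A_F v_l, v_m⟩ = δ_{lm} and T v_l = μ_l A_F v_l, let λ_TOL > 0, and let s ⊆ {1,…,n_F} satisfy λ_TOL·μ_l ≥ 1 for every l ∉ s. Then for every w ∈ ℝ^{n_F+n_i} with first block w_F ∈ ℝ^{n_F}, setting (w_F)_Π := Σ_{l ∈ s} ⟨A_F w_F, v_l⟩ v_l, one has ⟨A_F (w_F − (w_F)_Π), w_F − (w_F)_Π⟩ ≤ λ_TOL ⟨S^(i) w, w⟩. -/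
open Matrix Finset

/-- Schur complement: positive definiteness and the energy-minimisation inequality. -/
lemma fb_schur {m n : ℕ} (A : Matrix (Fin m) (Fin m) ℝ) (B : Matrix (Fin m) (Fin n) ℝ)
    (C : Matrix (Fin n) (Fin m) ℝ) (D : Matrix (Fin n) (Fin n) ℝ)
    (h : (Matrix.fromBlocks A B C D).PosDef) :
    (A - B * D⁻¹ * C).PosDef ∧ ∀ w : Fin m ⊕ Fin n → ℝ,
      ((A - B * D⁻¹ * C) *ᵥ (w ∘ Sum.inl)) ⬝ᵥ (w ∘ Sum.inl) ≤
        ((Matrix.fromBlocks A B C D) *ᵥ w) ⬝ᵥ w := by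
  have hD : D.PosDef := by
    have := h.submatrix (e := Sum.inr) Sum.inr_injective
    exact this
  obtain ⟨hA, hBC, hCB, -⟩ := Matrix.isHermitian_fromBlocks_iff.1 h.isHermitian
  subst hBC
  haveI : Invertible D := hD.isUnit.invertible
  have key : ∀ (x : Fin m → ℝ) (y : Fin n → ℝ),
      ((Matrix.fromBlocks A B Bᴴ D) *ᵥ (Sum.elim x y)) ⬝ᵥ (Sum.elim x y) =
      ((D *ᵥ ((D⁻¹ * Bᴴ) *ᵥ x + y)) ⬝ᵥ ((D⁻¹ * Bᴴ) *ᵥ x + y)) +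
        ((A - B * D⁻¹ * Bᴴ) *ᵥ x) ⬝ᵥ x := by
    intro x y
    have := Matrix.schur_complement_eq₂₂ A B x y hD.isHermitian
    simp only [star_trivial] at this
    simp only [← Matrix.dotProduct_mulVec] at this
    rw [dotProduct_comm, this, dotProduct_comm, dotProduct_comm x]
  have hsymm : (A - B * D⁻¹ * Bᴴ).IsHermitian :=
    (Matrix.IsHermitian.fromBlocks₂₂ A B hD.isHermitian).1 h.isHermitian
  refine ⟨Matrix.PosDef.of_dotProduct_mulVec_pos hsymm ?_, ?_⟩
  · intro x hx
    have h1 := key x (-((D⁻¹ * Bᴴ) *ᵥ x))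
    have h2 := h.dotProduct_mulVec_pos (x := Sum.elim x (-((D⁻¹ * Bᴴ) *ᵥ x))) (by
      intro h0
      apply hx
      funext i
      exact congrFun h0 (Sum.inl i))
    simp only [star_trivial] at h2 ⊢
    rw [dotProduct_comm, h1] at h2
    rw [dotProduct_comm]
    simpa using h2
  · intro w
    have h1 := key (w ∘ Sum.inl) (w ∘ Sum.inr)
    rw [Sum.elim_comp_inl_inr] at h1
    rw [h1]
    have h2 := hD.posSemidef.dotProduct_mulVec_nonneg
      ((D⁻¹ * Bᴴ) *ᵥ (w ∘ Sum.inl) + w ∘ Sum.inr)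
    simp only [star_trivial] at h2
    rw [dotProduct_comm] at h2
    linarith

/-- The parallel sum is dominated by its first argument. -/
lemma fb_parallel {m : ℕ} (X Y : Matrix (Fin m) (Fin m) ℝ) (hX : X.PosDef) (hY : Y.PosDef)
    (x : Fin m → ℝ) :
    ((X⁻¹ + Y⁻¹)⁻¹ *ᵥ x) ⬝ᵥ x ≤ (X *ᵥ x) ⬝ᵥ x := by
  have hS : (X⁻¹ + Y⁻¹).PosDef := hX.inv.add hY.inv
  set y := (X⁻¹ + Y⁻¹)⁻¹ *ᵥ x with hy
  have hx : x = X⁻¹ *ᵥ y + Y⁻¹ *ᵥ y := by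
    rw [← Matrix.add_mulVec, hy, Matrix.mulVec_mulVec,
      Matrix.mul_nonsing_inv _ ((Matrix.isUnit_iff_isUnit_det _).1 hS.isUnit), Matrix.one_mulVec]
  set a := X⁻¹ *ᵥ y with ha
  set b := Y⁻¹ *ᵥ y with hb
  have hXa : X *ᵥ a = y := by
    rw [ha, Matrix.mulVec_mulVec,
      Matrix.mul_nonsing_inv _ ((Matrix.isUnit_iff_isUnit_det _).1 hX.isUnit), Matrix.one_mulVec]
  have hyb : 0 ≤ y ⬝ᵥ b := by
    have := hY.inv.posSemidef.dotProduct_mulVec_nonneg y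
    simpa using this
  have hXb : 0 ≤ (X *ᵥ b) ⬝ᵥ b := by
    have := hX.posSemidef.dotProduct_mulVec_nonneg b
    rw [dotProduct_comm]
    simpa using this
  have hXt : Xᵀ = X := by simpa using hX.isHermitian.eq
  have hsym : (X *ᵥ b) ⬝ᵥ a = y ⬝ᵥ b := by
    rw [dotProduct_comm, Matrix.dotProduct_mulVec, ← Matrix.mulVec_transpose, hXt, hXa]
  rw [hx, Matrix.mulVec_add, hXa]
  simp only [dotProduct_add, add_dotProduct]
  rw [hsym]
  linarith

/-- Spectral estimate for an orthonormal system of generalized eigenvectors. -/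
lemma fb_spectral {m : ℕ} (A T : Matrix (Fin m) (Fin m) ℝ) (hA : Aᵀ = A)
    (v : Fin m → Fin m → ℝ) (μ : Fin m → ℝ) (hμ : ∀ l, 0 ≤ μ l)
    (horth : ∀ l k, (A *ᵥ v l) ⬝ᵥ v k = if l = k then 1 else 0)
    (heig : ∀ l, T *ᵥ v l = μ l • (A *ᵥ v l))
    (t : ℝ) (ht : 0 < t) (s : Finset (Fin m)) (hs : ∀ l ∉ s, 1 ≤ t * μ l) (x : Fin m → ℝ) :
    (A *ᵥ (x - ∑ l ∈ s, ((A *ᵥ x) ⬝ᵥ v l) • v l)) ⬝ᵥ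
      (x - ∑ l ∈ s, ((A *ᵥ x) ⬝ᵥ v l) • v l) ≤ t * ((T *ᵥ x) ⬝ᵥ x) := by
  set c : Fin m → ℝ := fun l => (A *ᵥ x) ⬝ᵥ v l with hc
  have hV : (Matrix.of v * A) * (Matrix.of v)ᵀ = 1 := by
    ext k l
    rw [Matrix.mul_assoc, Matrix.mul_apply_eq_vecMul, Matrix.one_apply]
    have := horth l k
    rw [dotProduct_comm] at this
    simp only [eq_comm (a := k)]
    rw [← this]
    simp [Matrix.mul_apply, Matrix.vecMul, Matrix.mulVec, dotProduct]
  have hV2 : (Matrix.of v)ᵀ * (Matrix.of v * A) = 1 := mul_eq_one_comm.1 hV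
  have hx : x = ∑ l, c l • v l := by
    have h1 : x = ((Matrix.of v)ᵀ * (Matrix.of v * A)) *ᵥ x := by rw [hV2, Matrix.one_mulVec]
    rw [← Matrix.mulVec_mulVec, ← Matrix.mulVec_mulVec] at h1
    conv_lhs => rw [h1]
    ext i
    simp only [Matrix.mulVec, dotProduct, hc, Finset.sum_apply, Pi.smul_apply, smul_eq_mul,
      Matrix.transpose_apply, Matrix.of_apply]
    refine Finset.sum_congr rfl fun l _ => ?_
    rw [mul_comm]
    congr 1
    exact Finset.sum_congr rfl fun j _ => mul_comm _ _
  have hquadA : ∀ r : Finset (Fin m),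
      (A *ᵥ (∑ l ∈ r, c l • v l)) ⬝ᵥ (∑ l ∈ r, c l • v l) = ∑ l ∈ r, c l ^ 2 := by
    intro r
    simp only [Matrix.mulVec_sum, Matrix.mulVec_smul, sum_dotProduct, dotProduct_sum,
      smul_dotProduct, dotProduct_smul, horth, smul_eq_mul]
    refine Finset.sum_congr rfl fun l hl => ?_
    simp [hl, sq]
  have hquadT : (T *ᵥ x) ⬝ᵥ x = ∑ l, μ l * c l ^ 2 := by
    conv_lhs => rw [hx]
    simp only [Matrix.mulVec_sum, Matrix.mulVec_smul, sum_dotProduct, dotProduct_sum,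
      smul_dotProduct, dotProduct_smul, heig, horth, smul_eq_mul]
    refine Finset.sum_congr rfl fun l hl => ?_
    simp
    ring
  have hsub : x - ∑ l ∈ s, c l • v l = ∑ l ∈ sᶜ, c l • v l := by
    rw [sub_eq_iff_eq_add, Finset.sum_compl_add_sum]
    exact hx
  change (A *ᵥ (x - ∑ l ∈ s, c l • v l)) ⬝ᵥ (x - ∑ l ∈ s, c l • v l) ≤ _
  rw [hsub, hquadA, hquadT, Finset.mul_sum, ← Finset.sum_compl_add_sum s]
  have h1 : ∑ l ∈ sᶜ, c l ^ 2 ≤ ∑ l ∈ sᶜ, t * (μ l * c l ^ 2) := by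
    refine Finset.sum_le_sum fun l hl => ?_
    have := hs l (Finset.mem_compl.1 hl)
    nlinarith [sq_nonneg (c l)]
  have h2 : 0 ≤ ∑ l ∈ s, t * (μ l * c l ^ 2) :=
    Finset.sum_nonneg fun l _ => mul_nonneg ht.le (mul_nonneg (hμ l) (sq_nonneg _))
  linarith

/-- **Lemma on the face bound.** Let `S⁽ⁱ⁾` be an
`(nF + ni) × (nF + ni)` real symmetric positive definite matrix in block form with
`(1,1)`-block `SiF`, and similarly `S⁽ʲ⁾` over `ℝ^{nF} ⊕ ℝ^{nj}` with `(1,1)`-block `SjF`.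
Let `S̃iF`, `S̃jF` be the Schur complements eliminating the second blocks. Let `DiF, DjF`
be arbitrary `nF × nF` matrices, `A_F = DjFᵀ SiF DjF + DiFᵀ SjF DiF` assumed positive
definite, and `T = (S̃iF⁻¹ + S̃jF⁻¹)⁻¹` the parallel sum `S̃iF : S̃jF`. Given an
`A_F`-orthonormal system of generalized eigenvectors `T vₗ = μₗ A_F vₗ`, a tolerance
`λTOL > 0` and a selected set `s` with `λTOL * μₗ ≥ 1` for `l ∉ s`, for every
`w ∈ ℝ^{nF + ni}` with first block `w_F`, the coarse component
`(w_F)_Π = ∑ l ∈ s, ⟨A_F w_F, vₗ⟩ vₗ` satisfies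
`⟨A_F (w_F - (w_F)_Π), w_F - (w_F)_Π⟩ ≤ λTOL ⟨S⁽ⁱ⁾ w, w⟩`. -/
theorem face_bound {nF ni nj : ℕ} (hnF : 0 < nF) (hni : 0 < ni) (hnj : 0 < nj)
    (SiFF : Matrix (Fin nF) (Fin nF) ℝ) (SiFI : Matrix (Fin nF) (Fin ni) ℝ)
    (SiIF : Matrix (Fin ni) (Fin nF) ℝ) (SiII : Matrix (Fin ni) (Fin ni) ℝ)
    (SjFF : Matrix (Fin nF) (Fin nF) ℝ) (SjFJ : Matrix (Fin nF) (Fin nj) ℝ)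
    (SjJF : Matrix (Fin nj) (Fin nF) ℝ) (SjJJ : Matrix (Fin nj) (Fin nj) ℝ)
    (hSi : (Matrix.fromBlocks SiFF SiFI SiIF SiII).PosDef)
    (hSj : (Matrix.fromBlocks SjFF SjFJ SjJF SjJJ).PosDef)
    (DiF DjF : Matrix (Fin nF) (Fin nF) ℝ)
    (hAF : (DjFᵀ * SiFF * DjF + DiFᵀ * SjFF * DiF).PosDef)
    (v : Fin nF → Fin nF → ℝ) (μ : Fin nF → ℝ) (hμ : ∀ l, 0 ≤ μ l)
    (horth : ∀ l m,
      ((DjFᵀ * SiFF * DjF + DiFᵀ * SjFF * DiF) *ᵥ v l) ⬝ᵥ v m = if l = m then 1 else 0)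
    (heig : ∀ l,
      ((SiFF - SiFI * SiII⁻¹ * SiIF)⁻¹ + (SjFF - SjFJ * SjJJ⁻¹ * SjJF)⁻¹)⁻¹ *ᵥ v l =
        μ l • ((DjFᵀ * SiFF * DjF + DiFᵀ * SjFF * DiF) *ᵥ v l))
    (lTOL : ℝ) (hTOL : 0 < lTOL) (s : Finset (Fin nF)) (hs : ∀ l ∉ s, 1 ≤ lTOL * μ l)
    (w : Fin nF ⊕ Fin ni → ℝ) :
    ((DjFᵀ * SiFF * DjF + DiFᵀ * SjFF * DiF) *ᵥ
        (w ∘ Sum.inl - ∑ l ∈ s,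
          (((DjFᵀ * SiFF * DjF + DiFᵀ * SjFF * DiF) *ᵥ (w ∘ Sum.inl)) ⬝ᵥ v l) • v l)) ⬝ᵥ
      (w ∘ Sum.inl - ∑ l ∈ s,
          (((DjFᵀ * SiFF * DjF + DiFᵀ * SjFF * DiF) *ᵥ (w ∘ Sum.inl)) ⬝ᵥ v l) • v l) ≤
    lTOL * (((Matrix.fromBlocks SiFF SiFI SiIF SiII) *ᵥ w) ⬝ᵥ w) := by
  obtain ⟨hX, hXw⟩ := fb_schur SiFF SiFI SiIF SiII hSi
  obtain ⟨hY, -⟩ := fb_schur SjFF SjFJ SjJF SjJJ hSj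
  refine (fb_spectral _ _ (by simpa using hAF.isHermitian.eq) v μ hμ horth heig lTOL hTOL s hs
    (w ∘ Sum.inl)).trans ?_
  exact mul_le_mul_of_nonneg_left ((fb_parallel _ _ hX hY _).trans (hXw w)) hTOL.le
end

section
/- Let I be a finite index set, for each m ∈ I let S_m be an n×n real symmetric positive semidefinite matrix and D_m an arbitrary n×n real matrix, and define A^(m) = Σ_{l ∈ I, l ≠ m} (D_lᵀ S_m D_l + D_mᵀ S_l D_m). Then for any vectors (w_m)_{m ∈ I} in ℝ^n and any p ∈ ℝ^n, setting z_m = w_m − p for each m ∈ I, one has Σ_{m ∈ I} Σ_{l ∈ I, l ≠ m} ⟨S_m D_l (w_m − w_l), D_l (w_m − w_l)⟩ ≤ 2 Σ_{m ∈ I} ⟨A^(m) z_m, z_m⟩. -/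
open Matrix Finset

theorem quad_sub_le {n : ℕ} (S D : Matrix (Fin n) (Fin n) ℝ) (hS : S.PosSemidef)
    (a b : Fin n → ℝ) :
    (S *ᵥ (D *ᵥ (a - b))) ⬝ᵥ (D *ᵥ (a - b)) ≤
      2 * ((S *ᵥ (D *ᵥ a)) ⬝ᵥ (D *ᵥ a) + (S *ᵥ (D *ᵥ b)) ⬝ᵥ (D *ᵥ b)) := by
  have h : 0 ≤ (S *ᵥ (D *ᵥ (a + b))) ⬝ᵥ (D *ᵥ (a + b)) := by
    have := hS.dotProduct_mulVec_nonneg (D *ᵥ (a + b))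
    rw [dotProduct_comm]
    simpa using this
  simp only [mulVec_add, mulVec_sub, add_dotProduct, dotProduct_add, sub_dotProduct,
    dotProduct_sub] at h ⊢
  linarith

theorem quad_conj {n : ℕ} (S D : Matrix (Fin n) (Fin n) ℝ) (z : Fin n → ℝ) :
    ((Dᵀ * S * D) *ᵥ z) ⬝ᵥ z = (S *ᵥ (D *ᵥ z)) ⬝ᵥ (D *ᵥ z) := by
  rw [← mulVec_mulVec, ← mulVec_mulVec, mulVec_transpose, ← dotProduct_mulVec]

/-- Let `I` be a finite index set, for each `m ∈ I` let `S m` be an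
`n × n` real symmetric positive semidefinite matrix and `D m` an arbitrary `n × n` real
matrix, and define `A⁽ᵐ⁾ = ∑ l ∈ I, l ≠ m, ((D l)ᵀ (S m) (D l) + (D m)ᵀ (S l) (D m))`.
Then for any vectors `(w m)_{m ∈ I}` in `ℝ^n` and any `p ∈ ℝ^n`, setting
`z m = w m - p` for each `m ∈ I`, one has
`∑ m ∈ I, ∑ l ∈ I, l ≠ m, ⟨S m (D l (w m - w l)), D l (w m - w l)⟩
  ≤ 2 ∑ m ∈ I, ⟨A⁽ᵐ⁾ (z m), z m⟩`. -/
theorem edge_jump_energy_bound {n : ℕ} {I : Type*} [Fintype I] [DecidableEq I]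
    (S D : I → Matrix (Fin n) (Fin n) ℝ) (hS : ∀ m, (S m).PosSemidef)
    (w : I → Fin n → ℝ) (p : Fin n → ℝ) :
    ∑ m : I, ∑ l ∈ Finset.univ.erase m,
        (S m *ᵥ (D l *ᵥ (w m - w l))) ⬝ᵥ (D l *ᵥ (w m - w l)) ≤
      2 * ∑ m : I,
        ((∑ l ∈ Finset.univ.erase m, ((D l)ᵀ * S m * D l + (D m)ᵀ * S l * D m)) *ᵥ
            (w m - p)) ⬝ᵥ (w m - p) := by
  have hR : ∀ m : I,
      ((∑ l ∈ Finset.univ.erase m, ((D l)ᵀ * S m * D l + (D m)ᵀ * S l * D m)) *ᵥ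
            (w m - p)) ⬝ᵥ (w m - p) =
      ∑ l ∈ Finset.univ.erase m, (S m *ᵥ (D l *ᵥ (w m - p))) ⬝ᵥ (D l *ᵥ (w m - p)) +
      ∑ l ∈ Finset.univ.erase m, (S l *ᵥ (D m *ᵥ (w m - p))) ⬝ᵥ (D m *ᵥ (w m - p)) := by
    intro m
    rw [sum_mulVec, sum_dotProduct, ← Finset.sum_add_distrib]
    refine Finset.sum_congr rfl fun l _ => ?_
    rw [add_mulVec, add_dotProduct, quad_conj, quad_conj]
  have hswap : ∑ m : I, ∑ l ∈ Finset.univ.erase m,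
        (S l *ᵥ (D m *ᵥ (w m - p))) ⬝ᵥ (D m *ᵥ (w m - p)) =
      ∑ m : I, ∑ l ∈ Finset.univ.erase m,
        (S m *ᵥ (D l *ᵥ (w l - p))) ⬝ᵥ (D l *ᵥ (w l - p)) := by
    refine Finset.sum_comm' fun x y => ?_
    simp [eq_comm]
  rw [Finset.sum_congr rfl fun m _ => hR m, Finset.sum_add_distrib, hswap,
    ← Finset.sum_add_distrib, Finset.mul_sum]
  refine Finset.sum_le_sum fun m _ => ?_
  rw [← Finset.sum_add_distrib, Finset.mul_sum]
  refine Finset.sum_le_sum fun l _ => ?_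
  have h := quad_sub_le (S m) (D l) (hS m) (w m - p) (w l - p)
  rwa [sub_sub_sub_cancel_right] at h
end

section
/- (Lemma on the edge bound.) Let I be a finite index set with at least two elements and let i ∈ I. Let n_E ≥ 1, and for each m ∈ I let n_m ≥ 1 and let S^(m) be an (n_E+n_m)×(n_E+n_m) real symmetric positive definite matrix written in 2×2 block form with respect to ℝ^{n_E} ⊕ ℝ^{n_m}, with (1,1)-block S_E^(m), and let S̃_E^(m) be the Schur complement of S^(m) eliminating the second block (symmetric positive definite). Let D_E^(m) (m ∈ I) be arbitrary n_E×n_E real matrices and define A_E = Σ_{m ∈ I} Σ_{l ∈ I, l ≠ m} (D_E^(l))ᵀ S_E^(m) D_E^(l), assumed positive definite, A_E^(i) = Σ_{l ∈ I, l ≠ i} ((D_E^(l))ᵀ S_E^(i) D_E^(l) + (D_E^(i))ᵀ S_E^(l) D_E^(i)), and T = (Σ_{m ∈ I} (S̃_E^(m))⁻¹)⁻¹, the iterated parallel sum of the S̃_E^(m). Suppose v_1,…,v_{n_E} ∈ ℝ^{n_E} and μ_1,…,μ_{n_E} ≥ 0 satisfy ⟨A_E v_l, v_m⟩ = δ_{lm}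 and T v_l = μ_l A_E v_l, let λ_TOL > 0, and let s ⊆ {1,…,n_E} satisfy λ_TOL·μ_l ≥ 1 for every l ∉ s. Then for every w ∈ ℝ^{n_E+n_i} with first block w_E ∈ ℝ^{n_E}, setting (w_E)_Π := Σ_{l ∈ s} ⟨A_E w_E, v_l⟩ v_l, one has ⟨A_E^(i) (w_E − (w_E)_Π), w_E − (w_E)_Π⟩ ≤ λ_TOL ⟨S^(i) w, w⟩. -/
open Matrix Finset

/-- The matrix `A_E = ∑ m ∈ I, ∑ l ∈ I, l ≠ m, (D l)ᵀ (SE m) (D l)` of the edge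
generalized eigenvalue problem. -/
def edgeAE {nE : ℕ} {I : Type*} [Fintype I] [DecidableEq I]
    (SE D : I → Matrix (Fin nE) (Fin nE) ℝ) : Matrix (Fin nE) (Fin nE) ℝ :=
  ∑ m : I, ∑ l ∈ Finset.univ.erase m, (D l)ᵀ * SE m * D l

/-- The matrix `A_E⁽ⁱ⁾ = ∑ l ∈ I, l ≠ i, ((D l)ᵀ (SE i) (D l) + (D i)ᵀ (SE l) (D i))`. -/
def edgeAEi {nE : ℕ} {I : Type*} [Fintype I] [DecidableEq I]
    (SE D : I → Matrix (Fin nE) (Fin nE) ℝ) (i : I) : Matrix (Fin nE) (Fin nE) ℝ :=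
  ∑ l ∈ Finset.univ.erase i, ((D l)ᵀ * SE i * D l + (D i)ᵀ * SE l * D i)

/-- Real positive semidefinite matrices have nonnegative quadratic form. -/
lemma eb_nonneg {n : Type*} [Fintype n] {M : Matrix n n ℝ} (h : M.PosSemidef) (x : n → ℝ) :
    0 ≤ (M *ᵥ x) ⬝ᵥ x := by
  have := h.dotProduct_mulVec_nonneg x
  rw [dotProduct_comm]
  simpa using this

/-- Self-adjointness of real Hermitian matrices. -/
lemma eb_symm {n : Type*} [Fintype n] {M : Matrix n n ℝ} (h : M.IsHermitian) (x y : n → ℝ) :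
    (M *ᵥ x) ⬝ᵥ y = x ⬝ᵥ (M *ᵥ y) := by
  have hT : Mᵀ = M := by simpa [IsHermitian, conjTranspose_eq_transpose_of_trivial] using h
  rw [dotProduct_mulVec, ← mulVec_transpose, hT]

/-- The Schur complement is positive definite and bounded by the full matrix. -/
lemma eb_schur {m n : Type*} [Fintype m] [Fintype n] [DecidableEq n]
    (A : Matrix m m ℝ) (B : Matrix m n ℝ) (C : Matrix n m ℝ) (D : Matrix n n ℝ)
    (h : (fromBlocks A B C D).PosDef) :
    (A - B * D⁻¹ * C).PosDef ∧ ∀ w : m ⊕ n → ℝ,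
      ((A - B * D⁻¹ * C) *ᵥ (w ∘ Sum.inl)) ⬝ᵥ (w ∘ Sum.inl) ≤
        ((fromBlocks A B C D) *ᵥ w) ⬝ᵥ w := by
  have hD : D.PosDef := by
    have := h.submatrix (e := (Sum.inr : n → m ⊕ n)) Sum.inr_injective
    exact this
  obtain ⟨hA, hBC, -, -⟩ := isHermitian_fromBlocks_iff.1 h.isHermitian
  subst hBC
  let _ : Invertible D := hD.isUnit.invertible
  have key := fun x y => schur_complement_eq₂₂ A B x y hD.isHermitian
  constructor
  · refine PosDef.of_dotProduct_mulVec_pos ?_ ?_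
    · exact (IsHermitian.fromBlocks₂₂ A B hD.isHermitian).1 h.isHermitian
    · intro x hx
      have hk := key x (-((D⁻¹ * Bᴴ) *ᵥ x))
      rw [add_neg_cancel, star_zero, zero_vecMul, zero_dotProduct, zero_add,
        ← dotProduct_mulVec, ← dotProduct_mulVec] at hk
      rw [← hk]
      apply h.dotProduct_mulVec_pos
      intro h0
      apply hx
      ext j
      exact congrFun h0 (Sum.inl j)
  · intro w
    have hk := key (w ∘ Sum.inl) (w ∘ Sum.inr)
    rw [Sum.elim_comp_inl_inr] at hk
    rw [← dotProduct_mulVec, ← dotProduct_mulVec, ← dotProduct_mulVec] at hk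
    have h1 := hD.posSemidef.dotProduct_mulVec_nonneg
      ((D⁻¹ * Bᴴ) *ᵥ (w ∘ Sum.inl) + w ∘ Sum.inr)
    simp only [star_trivial] at hk h1
    rw [dotProduct_comm, dotProduct_comm _ w, hk]
    linarith

/-- The iterated parallel sum is bounded by each of its members. -/
lemma eb_parallel {n I : Type*} [Fintype n] [DecidableEq n] [Fintype I] [DecidableEq I]
    (Q : I → Matrix n n ℝ) (hQ : ∀ m, (Q m).PosDef) (i : I) (x : n → ℝ) :
    (((∑ m, (Q m)⁻¹)⁻¹) *ᵥ x) ⬝ᵥ x ≤ (Q i *ᵥ x) ⬝ᵥ x ∧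
      ((∑ m, (Q m)⁻¹)⁻¹).PosSemidef := by
  have hN : (∑ m, (Q m)⁻¹).PosDef := by
    rw [← Finset.add_sum_erase _ _ (Finset.mem_univ i)]
    exact (hQ i).inv.add_posSemidef (posSemidef_sum _ fun m _ => (hQ m).inv.posSemidef)
  refine ⟨?_, hN.inv.posSemidef⟩
  set N := ∑ m, (Q m)⁻¹ with hNdef
  set z := N⁻¹ *ᵥ x with hz
  have hx : N *ᵥ z = x := by
    rw [hz, mulVec_mulVec, mul_nonsing_inv _ ((isUnit_iff_isUnit_det _).1 hN.isUnit), one_mulVec]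
  have h1 : ((Q i)⁻¹ *ᵥ z) ⬝ᵥ z ≤ (N *ᵥ z) ⬝ᵥ z := by
    have hp : (∑ m ∈ Finset.univ.erase i, (Q m)⁻¹).PosSemidef :=
      posSemidef_sum _ fun m _ => (hQ m).inv.posSemidef
    have := eb_nonneg hp z
    rw [hNdef, ← Finset.add_sum_erase _ _ (Finset.mem_univ i), add_mulVec, add_dotProduct]
    linarith
  have h2 := eb_nonneg (hQ i).posSemidef (x - (Q i)⁻¹ *ᵥ z)
  have h3 : Q i *ᵥ ((Q i)⁻¹ *ᵥ z) = z := by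
    rw [mulVec_mulVec, mul_nonsing_inv _ ((isUnit_iff_isUnit_det _).1 (hQ i).isUnit), one_mulVec]
  have h4 : (Q i *ᵥ x) ⬝ᵥ ((Q i)⁻¹ *ᵥ z) = z ⬝ᵥ x := by
    rw [eb_symm (hQ i).isHermitian, h3, dotProduct_comm]
  rw [mulVec_sub, h3, sub_dotProduct, dotProduct_sub, dotProduct_sub, h4,
    dotProduct_comm z ((Q i)⁻¹ *ᵥ z)] at h2
  rw [hx, dotProduct_comm x z] at h1
  linarith

/-- `A_E⁽ⁱ⁾ ≤ A_E`. -/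
lemma eb_AEi_le {nE : ℕ} {I : Type*} [Fintype I] [DecidableEq I]
    (SE D : I → Matrix (Fin nE) (Fin nE) ℝ) (hSE : ∀ m, (SE m).PosSemidef) (i : I)
    (y : Fin nE → ℝ) :
    (edgeAEi SE D i *ᵥ y) ⬝ᵥ y ≤ (edgeAE SE D *ᵥ y) ⬝ᵥ y := by
  have hP : ∀ m l, ((D l)ᵀ * SE m * D l).PosSemidef := fun m l => by
    simpa [conjTranspose_eq_transpose_of_trivial] using
      (hSE m).conjTranspose_mul_mul_same (D l)
  have hR : (∑ m ∈ Finset.univ.erase i, ∑ l ∈ (Finset.univ.erase m).erase i,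
      (D l)ᵀ * SE m * D l).PosSemidef :=
    posSemidef_sum _ fun m _ => posSemidef_sum _ fun l _ => hP m l
  have heq : edgeAE SE D = edgeAEi SE D i + ∑ m ∈ Finset.univ.erase i,
      ∑ l ∈ (Finset.univ.erase m).erase i, (D l)ᵀ * SE m * D l := by
    unfold edgeAE edgeAEi
    have hin : ∑ m ∈ Finset.univ.erase i, ∑ l ∈ Finset.univ.erase m, (D l)ᵀ * SE m * D l =
        ∑ m ∈ Finset.univ.erase i, ((D i)ᵀ * SE m * D i +
          ∑ l ∈ (Finset.univ.erase m).erase i, (D l)ᵀ * SE m * D l) := by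
      refine Finset.sum_congr rfl fun m hm => ?_
      exact (Finset.add_sum_erase (Finset.univ.erase m) (fun l => (D l)ᵀ * SE m * D l)
        (Finset.mem_erase.2 ⟨(Finset.ne_of_mem_erase hm).symm, Finset.mem_univ i⟩)).symm
    rw [← Finset.add_sum_erase _ _ (Finset.mem_univ i), hin, Finset.sum_add_distrib,
      Finset.sum_add_distrib, add_assoc]
  rw [heq, add_mulVec, add_dotProduct]
  linarith [eb_nonneg hR y]

/-- Expansion of a quadratic form in an orthonormal system. -/
lemma eb_quad {n : Type*} [Fintype n] [DecidableEq n] (A T : Matrix n n ℝ) (v : n → n → ℝ)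
    (μ : n → ℝ) (horth : ∀ l m, (A *ᵥ v l) ⬝ᵥ v m = if l = m then 1 else 0)
    (heig : ∀ l, T *ᵥ v l = μ l • (A *ᵥ v l)) (t : Finset n) (c : n → ℝ) :
    (T *ᵥ (∑ l ∈ t, c l • v l)) ⬝ᵥ (∑ l ∈ t, c l • v l) = ∑ l ∈ t, μ l * c l ^ 2 := by
  rw [mulVec_sum, sum_dotProduct]
  refine Finset.sum_congr rfl fun l hl => ?_
  rw [dotProduct_sum]
  simp only [mulVec_smul, heig, smul_dotProduct, dotProduct_smul, horth, smul_eq_mul]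
  simp [hl]
  ring

/-- Completeness of an orthonormal system. -/
lemma eb_expand {n : Type*} [Fintype n] [DecidableEq n] (A : Matrix n n ℝ) (hA : A.IsHermitian)
    (v : n → n → ℝ) (horth : ∀ l m, (A *ᵥ v l) ⬝ᵥ v m = if l = m then 1 else 0) (x : n → ℝ) :
    ∑ l, ((A *ᵥ x) ⬝ᵥ v l) • v l = x := by
  have h1 : (Matrix.of v * A) * (Matrix.of v)ᵀ = 1 := by
    ext l m
    rw [Matrix.one_apply, ← horth l m, eb_symm hA, Matrix.mul_assoc]
    rfl
  have h2 := mul_eq_one_comm.1 h1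
  have h3 : (Matrix.of v)ᵀ *ᵥ (Matrix.of v *ᵥ (A *ᵥ x)) = x := by
    rw [mulVec_mulVec, mulVec_mulVec, Matrix.mul_assoc, h2, one_mulVec]
  conv_rhs => rw [← h3]
  ext j
  simp only [Finset.sum_apply, Pi.smul_apply, smul_eq_mul]
  simp only [mulVec, dotProduct, Matrix.transpose_apply, Matrix.of_apply]
  refine Finset.sum_congr rfl fun l _ => ?_
  rw [mul_comm]
  congr 1
  exact Finset.sum_congr rfl fun k _ => mul_comm _ _

/-- **Lemma on the edge bound.** Let `I` be a finite index set with at least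
two elements and `i ∈ I`. For each `m ∈ I` let `S⁽ᵐ⁾` be a symmetric positive definite
matrix in block form over `ℝ^{nE} ⊕ ℝ^{nm m}` with `(1,1)`-block `SE m`, and let
`S̃E m = SE m - SEI m (SII m)⁻¹ SIE m` be its Schur complement. Let `DE m` be arbitrary
`nE × nE` matrices, `A_E = ∑ m, ∑ l ≠ m, (DE l)ᵀ (SE m) (DE l)` assumed positive
definite, `A_E⁽ⁱ⁾ = ∑ l ≠ i, ((DE l)ᵀ (SE i) (DE l) + (DE i)ᵀ (SE l) (DE i))`, and
`T = (∑ m, (S̃E m)⁻¹)⁻¹` the iterated parallel sum. Given an `A_E`-orthonormal system of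
generalized eigenvectors `T vₗ = μₗ A_E vₗ`, a tolerance `λTOL > 0` and a selected set `s`
with `λTOL * μₗ ≥ 1` for `l ∉ s`, for every `w ∈ ℝ^{nE + n_i}` with first block `w_E`,
the coarse component `(w_E)_Π = ∑ l ∈ s, ⟨A_E w_E, vₗ⟩ vₗ` satisfies
`⟨A_E⁽ⁱ⁾ (w_E - (w_E)_Π), w_E - (w_E)_Π⟩ ≤ λTOL ⟨S⁽ⁱ⁾ w, w⟩`. -/
theorem edge_bound {nE : ℕ} (hnE : 1 ≤ nE) {I : Type*} [Fintype I] [DecidableEq I]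
    (hcard : 2 ≤ Fintype.card I) (i : I)
    (nm : I → ℕ) (hnm : ∀ m, 1 ≤ nm m)
    (SE : I → Matrix (Fin nE) (Fin nE) ℝ)
    (SEI : (m : I) → Matrix (Fin nE) (Fin (nm m)) ℝ)
    (SIE : (m : I) → Matrix (Fin (nm m)) (Fin nE) ℝ)
    (SII : (m : I) → Matrix (Fin (nm m)) (Fin (nm m)) ℝ)
    (hS : ∀ m, (Matrix.fromBlocks (SE m) (SEI m) (SIE m) (SII m)).PosDef)
    (DE : I → Matrix (Fin nE) (Fin nE) ℝ)
    (hAE : (edgeAE SE DE).PosDef)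
    (v : Fin nE → Fin nE → ℝ) (μ : Fin nE → ℝ) (hμ : ∀ l, 0 ≤ μ l)
    (horth : ∀ l m, (edgeAE SE DE *ᵥ v l) ⬝ᵥ v m = if l = m then 1 else 0)
    (heig : ∀ l,
      (∑ m : I, (SE m - SEI m * (SII m)⁻¹ * SIE m)⁻¹)⁻¹ *ᵥ v l =
        μ l • (edgeAE SE DE *ᵥ v l))
    (lTOL : ℝ) (hTOL : 0 < lTOL) (s : Finset (Fin nE)) (hs : ∀ l ∉ s, 1 ≤ lTOL * μ l)
    (w : Fin nE ⊕ Fin (nm i) → ℝ) :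
    (edgeAEi SE DE i *ᵥ
        (w ∘ Sum.inl - ∑ l ∈ s, ((edgeAE SE DE *ᵥ (w ∘ Sum.inl)) ⬝ᵥ v l) • v l)) ⬝ᵥ
      (w ∘ Sum.inl - ∑ l ∈ s, ((edgeAE SE DE *ᵥ (w ∘ Sum.inl)) ⬝ᵥ v l) • v l) ≤
    lTOL * (((Matrix.fromBlocks (SE i) (SEI i) (SIE i) (SII i)) *ᵥ w) ⬝ᵥ w) := by
  
  have hSE : ∀ m, (SE m).PosSemidef := fun m => by
    have := (hS m).posSemidef.submatrix (Sum.inl : Fin nE → Fin nE ⊕ Fin (nm m))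
    exact this
  have hsch := fun m => eb_schur _ _ _ _ (hS m)
  refine (eb_AEi_le SE DE hSE i _).trans ?_
  set x := w ∘ Sum.inl with hx
  set c : Fin nE → ℝ := fun l => (edgeAE SE DE *ᵥ x) ⬝ᵥ v l with hc
  have hexp : ∑ l, c l • v l = x := eb_expand _ hAE.isHermitian v horth x
  have hy : x - ∑ l ∈ s, c l • v l = ∑ l ∈ sᶜ, c l • v l := by
    conv_lhs => rw [← hexp, ← Finset.sum_add_sum_compl s]
    simp
  have hT := (eb_parallel _ (fun m => (hsch m).1) i x).1
  have hTx := eb_quad _ _ v μ horth heig Finset.univ c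
  rw [hexp] at hTx
  have hAy := eb_quad _ (edgeAE SE DE) v (fun _ => 1) horth (by simp) sᶜ c
  change (edgeAE SE DE *ᵥ (x - ∑ l ∈ s, c l • v l)) ⬝ᵥ (x - ∑ l ∈ s, c l • v l) ≤ _
  rw [hy, hAy]
  calc ∑ l ∈ sᶜ, 1 * c l ^ 2 ≤ ∑ l ∈ sᶜ, lTOL * μ l * c l ^ 2 :=
        Finset.sum_le_sum fun l hl =>
          mul_le_mul_of_nonneg_right (hs l (Finset.mem_compl.1 hl)) (sq_nonneg _)
    _ ≤ ∑ l, lTOL * μ l * c l ^ 2 :=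
        Finset.sum_le_sum_of_subset_of_nonneg (Finset.subset_univ _) fun l _ _ =>
          mul_nonneg (mul_nonneg hTOL.le (hμ l)) (sq_nonneg _)
    _ = lTOL * ∑ l, μ l * c l ^ 2 := by
        rw [Finset.mul_sum]
        exact Finset.sum_congr rfl fun l _ => mul_assoc _ _ _
    _ ≤ _ := by
        rw [← hTx]
        exact mul_le_mul_of_nonneg_left (hT.trans ((hsch i).2 w)) hTOL.le
end

section
/- (Abstract BDDC condition number bound.) Let S̃ be an ñ×ñ real symmetric positive definite matrix, R̃ an ñ×n̂ real matrix and D̃ an ñ×ñ real matrix such that R̃ᵀ D̃ R̃ = I (the n̂×n̂ identity). Define the averaging operator E_D = R̃ R̃ᵀ D̃, the assembled matrix Ŝ = R̃ᵀ S̃ R̃ and the BDDC preconditioner M⁻¹ = R̃ᵀ D̃ S̃⁻¹ D̃ᵀ R̃. Assume c ≥ 1 is such that ⟨S̃ (I − E_D) w̃, (I − E_D) w̃⟩ ≤ c ⟨S̃ w̃, w̃⟩ for all w̃ ∈ ℝ^ñ. Then Ŝ and M⁻¹ are symmetric positive definite and every eigenvalue of M⁻¹ Ŝ lies in the interval [1,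 c]; in particular the spectral condition number of the preconditioned BDDC operator satisfies κ(M⁻¹ Ŝ) ≤ c. -/
open Matrix

/-- **Abstract BDDC condition number bound.** Let `S̃` be an `ñ × ñ` real
symmetric positive definite matrix, `R̃` an `ñ × n̂` real matrix and `D̃` an `ñ × ñ`
real matrix such that `R̃ᵀ D̃ R̃ = I`. Define the averaging operator `E_D = R̃ R̃ᵀ D̃`,
the assembled matrix `Ŝ = R̃ᵀ S̃ R̃` and the BDDC preconditioner
`M⁻¹ = R̃ᵀ D̃ S̃⁻¹ D̃ᵀ R̃`. Assume `c ≥ 1` is such that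
`⟨S̃ (I - E_D) w̃, (I - E_D) w̃⟩ ≤ c ⟨S̃ w̃, w̃⟩` for all `w̃`. Then `Ŝ` and `M⁻¹` are
symmetric positive definite and every eigenvalue of `M⁻¹ Ŝ` lies in `[1, c]`; in
particular `κ(M⁻¹ Ŝ) ≤ c`. -/
theorem bddc_condition_number_bound {nt nh : ℕ}
    (St : Matrix (Fin nt) (Fin nt) ℝ) (hSt : St.PosDef)
    (Rt : Matrix (Fin nt) (Fin nh) ℝ) (Dt : Matrix (Fin nt) (Fin nt) ℝ)
    (hpu : Rtᵀ * Dt * Rt = 1)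
    (c : ℝ) (hc : 1 ≤ c)
    (hED : ∀ w : Fin nt → ℝ,
      (St *ᵥ ((1 - Rt * Rtᵀ * Dt) *ᵥ w)) ⬝ᵥ ((1 - Rt * Rtᵀ * Dt) *ᵥ w) ≤
        c * ((St *ᵥ w) ⬝ᵥ w)) :
    (Rtᵀ * St * Rt).PosDef ∧ (Rtᵀ * Dt * St⁻¹ * Dtᵀ * Rt).PosDef ∧
    ∀ μ ∈ spectrum ℝ ((Rtᵀ * Dt * St⁻¹ * Dtᵀ * Rt) * (Rtᵀ * St * Rt)),
      μ ∈ Set.Icc (1 : ℝ) c := by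
  have hsym : Stᵀ = St := by
    have h : St.IsSymm := by simpa using hSt.1
    exact h
  have hdet : IsUnit St.det := (Matrix.isUnit_iff_isUnit_det _).1 hSt.isUnit
  have hpuT : Rtᵀ * Dtᵀ * Rt = 1 := by
    have := congrArg Matrix.transpose hpu
    simpa [Matrix.transpose_mul, Matrix.mul_assoc] using this
  have hRinj : Function.Injective Rt.mulVec := by
    intro x y hxy
    have := congrArg (fun v => (Rtᵀ * Dt) *ᵥ v) hxy
    simpa [Matrix.mulVec_mulVec, hpu] using this
  have hDRinj : Function.Injective (Dtᵀ * Rt).mulVec := by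
    intro x y hxy
    have := congrArg (fun v => Rtᵀ *ᵥ v) hxy
    simpa [Matrix.mulVec_mulVec, ← Matrix.mul_assoc, hpuT] using this
  have hS : (Rtᵀ * St * Rt).PosDef := by
    have := hSt.conjTranspose_mul_mul_same hRinj
    simpa using this
  have hM : (Rtᵀ * Dt * St⁻¹ * Dtᵀ * Rt).PosDef := by
    have := hSt.inv.conjTranspose_mul_mul_same hDRinj
    simpa [Matrix.mul_assoc] using this
  refine ⟨hS, hM, ?_⟩
  intro μ hμ
  rw [← Matrix.spectrum_toLin', ← Module.End.hasEigenvalue_iff_mem_spectrum] at hμ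
  obtain ⟨u, hu⟩ := hμ.exists_hasEigenvector
  have hu0 : u ≠ 0 := hu.2
  have hev := hu.apply_eq_smul
  rw [Matrix.toLin'_apply] at hev
  obtain ⟨f, hf⟩ : ∃ f, f = (Rtᵀ * St * Rt) *ᵥ u := ⟨_, rfl⟩
  obtain ⟨p, hp⟩ : ∃ p, p = Rt *ᵥ u := ⟨_, rfl⟩
  obtain ⟨w, hw⟩ : ∃ w, w = St⁻¹ *ᵥ ((Dtᵀ * Rt) *ᵥ f) := ⟨_, rfl⟩
  have hSw : St *ᵥ w = (Dtᵀ * Rt) *ᵥ f := by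
    rw [hw, Matrix.mulVec_mulVec, Matrix.mul_nonsing_inv _ hdet, Matrix.one_mulVec]
  have hRDw : (Rtᵀ * Dt) *ᵥ w = μ • u := by
    rw [← hev, hw, hf]
    simp only [Matrix.mulVec_mulVec, Matrix.mul_assoc]
  have hRDp : (Rtᵀ * Dt) *ᵥ p = u := by
    rw [hp, Matrix.mulVec_mulVec, hpu, Matrix.one_mulVec]
  have key : ∀ v, (St *ᵥ w) ⬝ᵥ v = f ⬝ᵥ ((Rtᵀ * Dt) *ᵥ v) := by
    intro v
    rw [hSw, Matrix.dotProduct_mulVec f, ← Matrix.mulVec_transpose]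
    simp
  obtain ⟨a, ha⟩ : ∃ a, a = f ⬝ᵥ u := ⟨_, rfl⟩
  have hapos : 0 < a := by
    have := hS.dotProduct_mulVec_pos hu0
    rw [ha, hf, dotProduct_comm]
    simpa using this
  have hww : (St *ᵥ w) ⬝ᵥ w = μ * a := by
    rw [key, hRDw, dotProduct_smul, ha, smul_eq_mul]
  have hwp : (St *ᵥ w) ⬝ᵥ p = a := by rw [key, hRDp, ha]
  have hcomm : ∀ x y, (St *ᵥ x) ⬝ᵥ y = (St *ᵥ y) ⬝ᵥ x := by
    intro x y
    rw [dotProduct_comm, Matrix.dotProduct_mulVec, ← Matrix.mulVec_transpose, hsym]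
  have hpw : (St *ᵥ p) ⬝ᵥ w = a := by rw [hcomm, hwp]
  have hpp : (St *ᵥ p) ⬝ᵥ p = a := by
    rw [ha, hf, hp, Matrix.dotProduct_mulVec, ← Matrix.mulVec_transpose]
    simp only [Matrix.mulVec_mulVec, Matrix.mul_assoc]
  have hE : (1 - Rt * Rtᵀ * Dt) *ᵥ (w - p) = w - μ • p := by
    rw [Matrix.sub_mulVec, Matrix.one_mulVec, Matrix.mul_assoc, ← Matrix.mulVec_mulVec,
      Matrix.mulVec_sub, hRDw, hRDp, Matrix.mulVec_sub, Matrix.mulVec_smul, ← hp]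
    abel
  have h1 : 0 ≤ (St *ᵥ (w - p)) ⬝ᵥ (w - p) := by
    have := hSt.posSemidef.dotProduct_mulVec_nonneg (w - p)
    rw [dotProduct_comm]
    simpa using this
  have h2 := hED (w - p)
  rw [hE] at h2
  simp only [Matrix.mulVec_sub, Matrix.mulVec_smul, sub_dotProduct, dotProduct_sub,
    smul_dotProduct, dotProduct_smul, smul_eq_mul, hww, hwp, hpw, hpp] at h1 h2
  have hμ1 : 1 ≤ μ := by nlinarith
  refine ⟨hμ1, ?_⟩
  by_contra! hlt
  have h3 : 0 < (μ - c) * ((μ - 1) * a) :=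
    mul_pos (by linarith) (mul_pos (by linarith) hapos)
  nlinarith
end

section
/- (FETI-DP lower bound.) Let S be an n×n real symmetric positive definite matrix, B and B_D m×n real matrices with B B_Dᵀ B = B (the jump operator P_D = B_Dᵀ B preserves jumps), U an m×p real matrix, F_DP = B S⁻¹ Bᵀ, and M⁻¹ = B_D S B_Dᵀ. Then for every λ ∈ ℝ^m and every z ∈ ℝ^n, ⟨λ, B z⟩² ≤ ⟨F_DP λ, λ⟩ · ⟨M⁻¹ (B z), B z⟩. In particular, for every λ with Uᵀ F_DP λ = 0, ⟨F_DP λ, λ⟩ ≥ sup { ⟨λ, μ⟩² / ⟨M⁻¹ μ, μ⟩ : μ in the column space of B, Uᵀ μ = 0, ⟨M⁻¹ μ, μ⟩ > 0 }. -/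
open Matrix

theorem fetidp_cauchy {n : ℕ} (S : Matrix (Fin n) (Fin n) ℝ) (hS : S.PosDef)
    (x w : Fin n → ℝ) :
    ((S *ᵥ x) ⬝ᵥ w) ^ 2 ≤ ((S *ᵥ x) ⬝ᵥ x) * ((S *ᵥ w) ⬝ᵥ w) := by
  have hT : Sᵀ = S := by
    have h := hS.isHermitian.eq
    rwa [conjTranspose_eq_transpose_of_trivial] at h
  have hsym : (S *ᵥ w) ⬝ᵥ x = (S *ᵥ x) ⬝ᵥ w := by
    rw [dotProduct_comm, dotProduct_mulVec, ← mulVec_transpose, hT]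
  have hq : ∀ t : ℝ, 0 ≤ ((S *ᵥ w) ⬝ᵥ w) * (t * t) + (2 * ((S *ᵥ x) ⬝ᵥ w)) * t
      + (S *ᵥ x) ⬝ᵥ x := by
    intro t
    have h := hS.posSemidef.dotProduct_mulVec_nonneg (x + t • w)
    rw [star_trivial, dotProduct_comm] at h
    simp only [mulVec_add, mulVec_smul, add_dotProduct, dotProduct_add, smul_dotProduct,
      dotProduct_smul, smul_eq_mul, hsym] at h
    linarith
  have hd := discrim_le_zero hq
  unfold discrim at hd
  linarith

/-- **FETI-DP lower bound.** Let `S` be an `n × n` real symmetric positive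
definite matrix, `B, B_D` be `m × n` real matrices with `B B_Dᵀ B = B` (the jump operator
`P_D = B_Dᵀ B` preserves jumps), `U` an `m × p` real matrix, `F_DP = B S⁻¹ Bᵀ` and
`M⁻¹ = B_D S B_Dᵀ`. Then for every `λ ∈ ℝ^m` and every `z ∈ ℝ^n`,
`⟨λ, B z⟩² ≤ ⟨F_DP λ, λ⟩ ⟨M⁻¹ (B z), B z⟩`. In particular, for every `λ` with
`Uᵀ F_DP λ = 0`, `⟨F_DP λ, λ⟩` dominates every value
`⟨λ, μ⟩² / ⟨M⁻¹ μ, μ⟩` with `μ ∈ Range B`, `Uᵀ μ = 0` and `⟨M⁻¹ μ, μ⟩ > 0`. -/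
theorem fetidp_lower_bound {n m p : ℕ}
    (S : Matrix (Fin n) (Fin n) ℝ) (hS : S.PosDef)
    (B B_D : Matrix (Fin m) (Fin n) ℝ) (hjump : B * B_Dᵀ * B = B)
    (U : Matrix (Fin m) (Fin p) ℝ) :
    (∀ (l : Fin m → ℝ) (z : Fin n → ℝ),
      (l ⬝ᵥ (B *ᵥ z)) ^ 2 ≤
        (((B * S⁻¹ * Bᵀ) *ᵥ l) ⬝ᵥ l) * (((B_D * S * B_Dᵀ) *ᵥ (B *ᵥ z)) ⬝ᵥ (B *ᵥ z))) ∧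
    ∀ l : Fin m → ℝ, Uᵀ *ᵥ ((B * S⁻¹ * Bᵀ) *ᵥ l) = 0 →
      ∀ μ : Fin m → ℝ, (∃ z : Fin n → ℝ, μ = B *ᵥ z) → Uᵀ *ᵥ μ = 0 →
        0 < ((B_D * S * B_Dᵀ) *ᵥ μ) ⬝ᵥ μ →
        (l ⬝ᵥ μ) ^ 2 / (((B_D * S * B_Dᵀ) *ᵥ μ) ⬝ᵥ μ) ≤ ((B * S⁻¹ * Bᵀ) *ᵥ l) ⬝ᵥ l := by
  have main : ∀ (l : Fin m → ℝ) (z : Fin n → ℝ),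
      (l ⬝ᵥ (B *ᵥ z)) ^ 2 ≤
        (((B * S⁻¹ * Bᵀ) *ᵥ l) ⬝ᵥ l) *
          (((B_D * S * B_Dᵀ) *ᵥ (B *ᵥ z)) ⬝ᵥ (B *ᵥ z)) := by
    intro l z
    have hdet : IsUnit S.det := hS.det_pos.ne'.isUnit
    have hc := fetidp_cauchy S hS (S⁻¹ *ᵥ (Bᵀ *ᵥ l)) (B_Dᵀ *ᵥ (B *ᵥ z))
    have hSx : S *ᵥ (S⁻¹ *ᵥ (Bᵀ *ᵥ l)) = Bᵀ *ᵥ l := by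
      rw [mulVec_mulVec, mul_nonsing_inv S hdet, one_mulVec]
    rw [hSx] at hc
    have h1 : (Bᵀ *ᵥ l) ⬝ᵥ (B_Dᵀ *ᵥ (B *ᵥ z)) = l ⬝ᵥ (B *ᵥ z) := by
      rw [mulVec_transpose, ← dotProduct_mulVec, mulVec_mulVec, mulVec_mulVec, hjump]
    have h2 : (Bᵀ *ᵥ l) ⬝ᵥ (S⁻¹ *ᵥ (Bᵀ *ᵥ l)) = ((B * S⁻¹ * Bᵀ) *ᵥ l) ⬝ᵥ l := by
      rw [← mulVec_mulVec, ← mulVec_mulVec, dotProduct_comm _ l, dotProduct_mulVec l B,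
        ← mulVec_transpose B l]
    have h3 : (S *ᵥ (B_Dᵀ *ᵥ (B *ᵥ z))) ⬝ᵥ (B_Dᵀ *ᵥ (B *ᵥ z)) =
        ((B_D * S * B_Dᵀ) *ᵥ (B *ᵥ z)) ⬝ᵥ (B *ᵥ z) := by
      generalize B *ᵥ z = y
      rw [← mulVec_mulVec, ← mulVec_mulVec, dotProduct_comm _ y, dotProduct_mulVec y B_D,
        ← mulVec_transpose B_D y, dotProduct_comm]
    rwa [h1, h2, h3] at hc
  refine ⟨main, ?_⟩
  rintro l - μ ⟨z, rfl⟩ - hpos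
  rw [div_le_iff₀ hpos]
  exact main l z
end

section
/- (Condition number bound for the FETI-DP method with projector preconditioner.) Let S be an n×n real symmetric positive definite matrix, B and B_D m×n real matrices with B B_Dᵀ B = B, and U an m×p real matrix. Set F_DP = B S⁻¹ Bᵀ, assume Uᵀ F_DP U is invertible, and set P = U (Uᵀ F_DP U)⁻¹ Uᵀ F_DP. Let P_B be the m×m real symmetric idempotent matrix whose column space equals the column space of B (the orthogonal projection onto Range(B)). Set M_FETI⁻¹ = B_D S B_Dᵀ and M_PP⁻¹ = P_Bᵀ (I − P) M_FETI⁻¹ (I − P)ᵀ P_B. Assume c > 0 is such that for every z ∈ ℝ^n with Uᵀ (B z) = 0 one has ⟨S B_Dᵀ B z, B_Dᵀ B z⟩ ≤ c ⟨S z, z⟩. Then for every μ ∈ ℝ^m, ⟨M_PP⁻¹ μ, μ⟩ ≤ ⟨F_DP M_PP⁻¹ μ, M_PP⁻¹ μ⟩ ≤ c · ⟨M_PP⁻¹ μ, μ⟩; that is, all generalized Rayleigh quotients of the preconditioned FETI-DP operator M_PP⁻¹ F_DP lie in the interval [1, c], so κ(M_PP⁻¹ F_DP) ≤ c. -/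
open Matrix

/-- The FETI-DP dual system matrix `F_DP = B S⁻¹ Bᵀ`. -/
noncomputable def FDP {n m : ℕ} (S : Matrix (Fin n) (Fin n) ℝ) (B : Matrix (Fin m) (Fin n) ℝ) :
    Matrix (Fin m) (Fin m) ℝ :=
  B * S⁻¹ * Bᵀ

/-- The projector preconditioner
`M_PP⁻¹ = P_Bᵀ (I - P) (B_D S B_Dᵀ) (I - P)ᵀ P_B` with
`P = U (Uᵀ F_DP U)⁻¹ Uᵀ F_DP`. -/
noncomputable def MPPinv {n m p : ℕ} (S : Matrix (Fin n) (Fin n) ℝ)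
    (B B_D : Matrix (Fin m) (Fin n) ℝ) (U : Matrix (Fin m) (Fin p) ℝ)
    (P_B : Matrix (Fin m) (Fin m) ℝ) : Matrix (Fin m) (Fin m) ℝ :=
  P_Bᵀ * (1 - U * (Uᵀ * FDP S B * U)⁻¹ * Uᵀ * FDP S B) * (B_D * S * B_Dᵀ) *
    (1 - U * (Uᵀ * FDP S B * U)⁻¹ * Uᵀ * FDP S B)ᵀ * P_B

/-- **Condition number bound for FETI-DP with projector preconditioner.**
Let `S` be `n × n` real symmetric positive definite, `B, B_D` be `m × n` real matrices
with `B B_Dᵀ B = B`, and `U` an `m × p` real matrix. Set `F_DP = B S⁻¹ Bᵀ`, assume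
`Uᵀ F_DP U` is invertible, and set `P = U (Uᵀ F_DP U)⁻¹ Uᵀ F_DP`. Let `P_B` be the
`m × m` real symmetric idempotent matrix whose column space equals the column space of
`B`. Set `M_FETI⁻¹ = B_D S B_Dᵀ` and `M_PP⁻¹ = P_Bᵀ (I - P) M_FETI⁻¹ (I - P)ᵀ P_B`.
Assume `c > 0` is such that `⟨S B_Dᵀ B z, B_Dᵀ B z⟩ ≤ c ⟨S z, z⟩` for every `z` with
`Uᵀ (B z) = 0`. Then for every `μ ∈ ℝ^m`,
`⟨M_PP⁻¹ μ, μ⟩ ≤ ⟨F_DP (M_PP⁻¹ μ), M_PP⁻¹ μ⟩ ≤ c ⟨M_PP⁻¹ μ, μ⟩`; that is, all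
generalized Rayleigh quotients of `M_PP⁻¹ F_DP` lie in `[1, c]`, so
`κ(M_PP⁻¹ F_DP) ≤ c`. -/
theorem fetidp_projector_condition_number_bound {n m p : ℕ}
    (S : Matrix (Fin n) (Fin n) ℝ) (hS : S.PosDef)
    (B B_D : Matrix (Fin m) (Fin n) ℝ) (hjump : B * B_Dᵀ * B = B)
    (U : Matrix (Fin m) (Fin p) ℝ)
    (hU : IsUnit (Uᵀ * FDP S B * U))
    (P_B : Matrix (Fin m) (Fin m) ℝ) (hPBsymm : P_Bᵀ = P_B)
    (hPBidem : P_B * P_B = P_B)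
    (hPBrange : LinearMap.range P_B.mulVecLin = LinearMap.range B.mulVecLin)
    (c : ℝ) (hc : 0 < c)
    (hPD : ∀ z : Fin n → ℝ, Uᵀ *ᵥ (B *ᵥ z) = 0 →
      (S *ᵥ ((B_Dᵀ * B) *ᵥ z)) ⬝ᵥ ((B_Dᵀ * B) *ᵥ z) ≤ c * ((S *ᵥ z) ⬝ᵥ z)) :
    ∀ μ : Fin m → ℝ,
      (MPPinv S B B_D U P_B *ᵥ μ) ⬝ᵥ μ ≤
          (FDP S B *ᵥ (MPPinv S B B_D U P_B *ᵥ μ)) ⬝ᵥ (MPPinv S B B_D U P_B *ᵥ μ) ∧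
      (FDP S B *ᵥ (MPPinv S B B_D U P_B *ᵥ μ)) ⬝ᵥ (MPPinv S B B_D U P_B *ᵥ μ) ≤
          c * ((MPPinv S B B_D U P_B *ᵥ μ) ⬝ᵥ μ) := by
  intro μ
  have hSt : Sᵀ = S := by simpa [Matrix.IsHermitian, conjTranspose_eq_transpose_of_trivial] using hS.isHermitian
  have hSu : IsUnit S.det := (Matrix.isUnit_iff_isUnit_det S).mp hS.isUnit
  have hpos : ∀ a : Fin n → ℝ, 0 ≤ (S *ᵥ a) ⬝ᵥ a := by
    intro a
    have h := hS.posSemidef.dotProduct_mulVec_nonneg a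
    rw [dotProduct_comm]
    simpa using h
  have hPB : P_B * B = B := by
    apply Matrix.ext_of_mulVec_single
    intro i
    have h : B *ᵥ Pi.single i 1 ∈ LinearMap.range P_B.mulVecLin := by
      rw [hPBrange]; exact ⟨_, rfl⟩
    obtain ⟨y, hy⟩ := h
    rw [mulVecLin_apply] at hy
    rw [← mulVec_mulVec, ← hy, mulVec_mulVec, hPBidem]
  have hBP : B * B_Dᵀ * P_B = P_B := by
    apply Matrix.ext_of_mulVec_single
    intro i
    have h : P_B *ᵥ Pi.single i 1 ∈ LinearMap.range B.mulVecLin := by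
      rw [← hPBrange]; exact ⟨_, rfl⟩
    obtain ⟨y, hy⟩ := h
    rw [mulVecLin_apply] at hy
    rw [← mulVec_mulVec, ← hy, mulVec_mulVec, hjump]
  have hMdef : MPPinv S B B_D U P_B = P_Bᵀ * (1 - U * (Uᵀ * FDP S B * U)⁻¹ * Uᵀ * FDP S B) * (B_D * S * B_Dᵀ) *
    (1 - U * (Uᵀ * FDP S B * U)⁻¹ * Uᵀ * FDP S B)ᵀ * P_B := rfl
  have hFdef : FDP S B = B * (S⁻¹ * Bᵀ) := by rw [FDP, Matrix.mul_assoc]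
  have hFt : (FDP S B)ᵀ = FDP S B := by
    simp [FDP, transpose_mul, transpose_nonsing_inv, hSt, Matrix.mul_assoc]
  have hPF : P_B * FDP S B = FDP S B := by rw [hFdef, ← Matrix.mul_assoc, hPB]
  have hBF : B * B_Dᵀ * FDP S B = FDP S B := by rw [hFdef, ← Matrix.mul_assoc, hjump]
  generalize FDP S B = F at *
  have hFP : F * P_B = F := by
    have := congrArg transpose hPF
    rwa [transpose_mul, hFt, hPBsymm] at this
  have hKd : IsUnit (Uᵀ * F * U).det := (Matrix.isUnit_iff_isUnit_det _).mp hU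
  have hK1 := Matrix.nonsing_inv_mul _ hKd
  have hK2 := Matrix.mul_nonsing_inv _ hKd
  have hKt : ((Uᵀ * F * U)⁻¹)ᵀ = (Uᵀ * F * U)⁻¹ := by
    rw [transpose_nonsing_inv]
    simp [transpose_mul, hFt, Matrix.mul_assoc]
  generalize (Uᵀ * F * U)⁻¹ = K at *
  have hQt : (1 - U * K * Uᵀ * F)ᵀ = 1 - F * U * K * Uᵀ := by
    simp [transpose_mul, hFt, hKt, Matrix.mul_assoc]
  have hUFQ : Uᵀ * F * (1 - U * K * Uᵀ * F) = 0 := by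
    have : Uᵀ * F * (1 - U * K * Uᵀ * F) = Uᵀ * F - (Uᵀ * F * U * K) * (Uᵀ * F) := by
      simp only [Matrix.mul_sub, Matrix.mul_one, Matrix.mul_assoc]
    rw [this, hK2]; simp
  have hUQt : Uᵀ * (1 - F * U * K * Uᵀ) = 0 := by
    have : Uᵀ * (1 - F * U * K * Uᵀ) = Uᵀ - (Uᵀ * F * U * K) * Uᵀ := by
      simp only [Matrix.mul_sub, Matrix.mul_one, Matrix.mul_assoc]
    rw [this, hK2]; simp
  have hBQ : B * B_Dᵀ * ((1 - F * U * K * Uᵀ) * P_B) = (1 - F * U * K * Uᵀ) * P_B := by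
    have : B * B_Dᵀ * ((1 - F * U * K * Uᵀ) * P_B)
        = B * B_Dᵀ * P_B - (B * B_Dᵀ * F) * (U * K * Uᵀ * P_B) := by
      simp only [Matrix.mul_sub, Matrix.sub_mul, Matrix.one_mul, Matrix.mul_assoc]
    rw [this, hBP, hBF]
    simp only [Matrix.sub_mul, Matrix.one_mul, Matrix.mul_assoc]
  have hQFQ : (1 - F * U * K * Uᵀ) * F * (1 - U * K * Uᵀ * F) = F * (1 - U * K * Uᵀ * F) := by
    have : (1 - F * U * K * Uᵀ) * F * (1 - U * K * Uᵀ * F)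
        = F * (1 - U * K * Uᵀ * F) - F * U * K * (Uᵀ * F * (1 - U * K * Uᵀ * F)) := by
      simp only [Matrix.mul_sub, Matrix.sub_mul, Matrix.one_mul, Matrix.mul_one, Matrix.mul_assoc]
    rw [this, hUFQ]; simp
  have hQQ : (1 - F * U * K * Uᵀ) * (1 - F * U * K * Uᵀ) = 1 - F * U * K * Uᵀ := by
    have : (1 - F * U * K * Uᵀ) * (1 - F * U * K * Uᵀ)
        = (1 - F * U * K * Uᵀ) - F * U * K * (Uᵀ * (1 - F * U * K * Uᵀ)) := by
      simp only [Matrix.mul_sub, Matrix.sub_mul, Matrix.one_mul, Matrix.mul_one, Matrix.mul_assoc]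
    rw [this, hUQt]; simp
  rw [hQt, hPBsymm] at hMdef
  generalize 1 - F * U * K * Uᵀ = Qt at *
  generalize 1 - U * K * Uᵀ * F = Q at *
  rw [hMdef]
  -- moving matrices across the dot product
  have adj : ∀ {k l : ℕ} (A : Matrix (Fin k) (Fin l) ℝ) (a : Fin l → ℝ) (b : Fin k → ℝ),
      (A *ᵥ a) ⬝ᵥ b = a ⬝ᵥ (Aᵀ *ᵥ b) := by
    intro k l A a b
    rw [mulVec_transpose, dotProduct_comm, dotProduct_mulVec, dotProduct_comm]
  obtain ⟨v, hv⟩ : ∃ v, v = (Qt * P_B) *ᵥ μ := ⟨_, rfl⟩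
  obtain ⟨x, hx⟩ : ∃ x, x = B_Dᵀ *ᵥ v := ⟨_, rfl⟩
  obtain ⟨g, hg⟩ : ∃ g, g = B_D *ᵥ (S *ᵥ x) := ⟨_, rfl⟩
  obtain ⟨z, hz⟩ : ∃ z, z = (S⁻¹ * Bᵀ) *ᵥ (Q *ᵥ g) := ⟨_, rfl⟩
  have hlam : (P_B * Q * (B_D * S * B_Dᵀ) * Qt * P_B) *ᵥ μ = P_B *ᵥ (Q *ᵥ g) := by
    rw [hg, hx, hv]; simp only [mulVec_mulVec, Matrix.mul_assoc]
  have hBx : B *ᵥ x = v := by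
    rw [hx, hv, mulVec_mulVec, mulVec_mulVec, hBQ]
  have hQv : Qt *ᵥ v = v := by
    rw [hv, mulVec_mulVec, ← Matrix.mul_assoc, hQQ]
  have hBz : B *ᵥ z = F *ᵥ (Q *ᵥ g) := by
    rw [hz, mulVec_mulVec, ← hFdef]
  have hSz : S *ᵥ z = Bᵀ *ᵥ (Q *ᵥ g) := by
    rw [hz, mulVec_mulVec, ← Matrix.mul_assoc, Matrix.mul_nonsing_inv _ hSu, Matrix.one_mul]
  have hb : (P_B *ᵥ (Q *ᵥ g)) ⬝ᵥ μ = (S *ᵥ x) ⬝ᵥ x := by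
    rw [adj, adj, hPBsymm, hQt, mulVec_mulVec, ← hv, hg, adj, ← hx]
  have ha : (F *ᵥ (P_B *ᵥ (Q *ᵥ g))) ⬝ᵥ (P_B *ᵥ (Q *ᵥ g)) = (S *ᵥ z) ⬝ᵥ z := by
    rw [mulVec_mulVec, hFP, dotProduct_comm, adj, hPBsymm, mulVec_mulVec, hPF, hSz, adj Bᵀ,
      transpose_transpose, hBz]
  have hsym : ∀ a b : Fin n → ℝ, (S *ᵥ a) ⬝ᵥ b = (S *ᵥ b) ⬝ᵥ a := by
    intro a b
    rw [adj, hSt, dotProduct_comm]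
  have hzx : (S *ᵥ z) ⬝ᵥ x = (S *ᵥ x) ⬝ᵥ x := by
    rw [hSz, adj, transpose_transpose, hBx, adj, hQt, hQv, hg, adj, ← hx]
  have hxy : (S *ᵥ x) ⬝ᵥ ((B_Dᵀ * B) *ᵥ z) = (S *ᵥ z) ⬝ᵥ z := by
    have e1 : (S *ᵥ x) ⬝ᵥ ((B_Dᵀ * B) *ᵥ z) = g ⬝ᵥ (F *ᵥ (Q *ᵥ g)) := by
      rw [← mulVec_mulVec, ← adj, ← hg, hBz]
    have e2 : (S *ᵥ z) ⬝ᵥ z = g ⬝ᵥ (F *ᵥ (Q *ᵥ g)) := by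
      rw [hSz, adj, transpose_transpose, hBz, adj, hQt, mulVec_mulVec, mulVec_mulVec,
        hQFQ, mulVec_mulVec]
    rw [e1, e2]
  have hUz : Uᵀ *ᵥ (B *ᵥ z) = 0 := by
    rw [hBz, mulVec_mulVec, mulVec_mulVec, hUFQ, zero_mulVec]
  have hy := hPD z hUz
  generalize (B_Dᵀ * B) *ᵥ z = y at *
  rw [hlam, ha, hb]
  constructor
  · have h := hpos (x - z)
    simp only [mulVec_sub, sub_dotProduct, dotProduct_sub] at h
    rw [hsym x z, hzx] at h
    linarith
  · have h := hpos (c • x - y)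
    simp only [mulVec_sub, mulVec_smul, sub_dotProduct, dotProduct_sub, smul_dotProduct,
      dotProduct_smul, smul_eq_mul] at h
    rw [hsym y x, hxy] at h
    have h2 : 0 ≤ c * (c * ((S *ᵥ x) ⬝ᵥ x) - (S *ᵥ z) ⬝ᵥ z) := by nlinarith
    have := nonneg_of_mul_nonneg_right h2 hc
    linarith
end

section
/- Let S̃ be an n×n real symmetric positive definite matrix and P_D an n×n real matrix with P_D² = P_D. Then every nonzero eigenvalue of the matrix G_d = P_Dᵀ S̃ P_D S̃⁻¹ is greater than or equal to 1. -/
open Matrix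

/-- Let `S̃` be an `n × n` real symmetric positive definite matrix and
`P_D` an `n × n` real matrix with `P_D² = P_D`. Then every nonzero eigenvalue of
`G_d = P_Dᵀ S̃ P_D S̃⁻¹` is greater than or equal to `1`. -/
theorem nonzero_eigenvalues_ge_one {n : ℕ}
    (St : Matrix (Fin n) (Fin n) ℝ) (hSt : St.PosDef)
    (P_D : Matrix (Fin n) (Fin n) ℝ) (hP : P_D * P_D = P_D) :
    ∀ μ ∈ spectrum ℝ (P_Dᵀ * St * P_D * St⁻¹), μ ≠ 0 → 1 ≤ μ := by
  intro μ hμ h0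
  have hdet : IsUnit St.det := hSt.det_pos.ne'.isUnit
  rw [← Matrix.spectrum_toLin', ← Module.End.hasEigenvalue_iff_mem_spectrum] at hμ
  obtain ⟨v, hv⟩ := hμ.exists_hasEigenvector
  have hv0 := hv.2
  have hve := hv.apply_eq_smul
  rw [Matrix.toLin'_apply] at hve
  obtain ⟨w, rfl⟩ : ∃ w, v = St *ᵥ w :=
    ⟨St⁻¹ *ᵥ v, by rw [Matrix.mulVec_mulVec, Matrix.mul_nonsing_inv _ hdet, Matrix.one_mulVec]⟩
  have hw0 : w ≠ 0 := by
    rintro rfl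
    exact hv0 (Matrix.mulVec_zero _)
  rw [Matrix.mulVec_mulVec, Matrix.mul_assoc, Matrix.nonsing_inv_mul _ hdet, Matrix.mul_one] at hve
  have hPt : P_Dᵀ * P_Dᵀ = P_Dᵀ := by rw [← Matrix.transpose_mul, hP]
  have hfix : P_Dᵀ *ᵥ (St *ᵥ w) = St *ᵥ w := by
    have h := congrArg (fun x => P_Dᵀ *ᵥ x) hve
    simp only [Matrix.mulVec_mulVec, ← Matrix.mul_assoc, hPt, Matrix.mulVec_smul] at h
    rw [hve] at h
    rw [Matrix.mulVec_mulVec]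
    exact (smul_right_injective _ h0 h).symm
  have hT : Stᵀ = St := by simpa using hSt.isHermitian.eq
  have hadj : ∀ x y : Fin n → ℝ, (P_D *ᵥ x) ⬝ᵥ y = x ⬝ᵥ (P_Dᵀ *ᵥ y) := by
    intro x y
    rw [Matrix.dotProduct_mulVec, Matrix.vecMul_transpose]
  have hsym : ∀ x y : Fin n → ℝ, x ⬝ᵥ (St *ᵥ y) = y ⬝ᵥ (St *ᵥ x) := by
    intro x y
    rw [Matrix.dotProduct_mulVec, ← Matrix.mulVec_transpose, hT, dotProduct_comm]
  have ha : 0 < w ⬝ᵥ (St *ᵥ w) := by simpa using hSt.dotProduct_mulVec_pos hw0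
  have hb : (P_D *ᵥ w) ⬝ᵥ (St *ᵥ (P_D *ᵥ w)) = μ * (w ⬝ᵥ (St *ᵥ w)) := by
    rw [hadj, Matrix.mulVec_mulVec, Matrix.mulVec_mulVec, hve,
      dotProduct_smul, smul_eq_mul]
  have hc : (P_D *ᵥ w) ⬝ᵥ (St *ᵥ w) = w ⬝ᵥ (St *ᵥ w) := by rw [hadj, hfix]
  have hd : 0 ≤ (P_D *ᵥ w - w) ⬝ᵥ (St *ᵥ (P_D *ᵥ w - w)) := by
    simpa using hSt.posSemidef.dotProduct_mulVec_nonneg (P_D *ᵥ w - w)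
  rw [Matrix.mulVec_sub, sub_dotProduct, dotProduct_sub, dotProduct_sub,
    hsym w (P_D *ᵥ w), hb, hc] at hd
  nlinarith
end

section
/- Let S̃ be an n×n real symmetric positive definite matrix, let P be an n×n real matrix with P² = P, and set E = I − P. Then the spectra of G_p = E S̃⁻¹ Eᵀ S̃ and G_d = Pᵀ S̃ P S̃⁻¹ coincide except possibly for the values 0 and 1: spectrum(G_p) \ {0, 1} = spectrum(G_d) \ {0, 1}. -/
open Matrix

lemma mem_spec_iff_aux {n : ℕ} (A : Matrix (Fin n) (Fin n) ℝ) (r : ℝ) :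
    r ∈ spectrum ℝ A ↔ ∃ v : Fin n → ℝ, v ≠ 0 ∧ A *ᵥ v = r • v := by
  rw [spectrum.mem_iff, Matrix.isUnit_iff_isUnit_det, isUnit_iff_ne_zero, not_not,
    ← Matrix.exists_mulVec_eq_zero_iff]
  refine exists_congr fun v => and_congr_right fun _ => ?_
  rw [Matrix.sub_mulVec, sub_eq_zero, Algebra.algebraMap_eq_smul_one, Matrix.smul_mulVec,
    Matrix.one_mulVec, eq_comm]

lemma core_aux {n : ℕ} (P Q : Matrix (Fin n) (Fin n) ℝ) (hP : P * P = P) (hQ : Q * Q = Q)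
    (r : ℝ) (h0 : r ≠ 0) (h1 : r ≠ 1) :
    r ∈ spectrum ℝ ((1 - P) * (1 - Q)) ↔ r ∈ spectrum ℝ (Q * P) := by
  rw [mem_spec_iff_aux, mem_spec_iff_aux]
  constructor
  · rintro ⟨u, hu, h⟩
    refine ⟨Q *ᵥ u, fun hz => ?_, ?_⟩
    · have hPu : r • (P *ᵥ u) = 0 := by
        rw [← Matrix.mulVec_smul, ← h, Matrix.mulVec_mulVec, ← mul_assoc, mul_sub P 1 P, mul_one, hP]
        simp
      have hPu' : P *ᵥ u = 0 := (smul_eq_zero.mp hPu).resolve_left h0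
      rw [← Matrix.mulVec_mulVec, Matrix.sub_mulVec 1 Q, hz, Matrix.one_mulVec, sub_zero,
        Matrix.sub_mulVec, hPu', Matrix.one_mulVec, sub_zero] at h
      have h2 : (1 - r) • u = 0 := by rw [sub_smul, one_smul, ← h, sub_self]
      exact (smul_eq_zero.mp h2).elim (fun h => h1 (by linarith)) hu
    · have hPu : r • (P *ᵥ u) = 0 := by
        rw [← Matrix.mulVec_smul, ← h, Matrix.mulVec_mulVec, ← mul_assoc, mul_sub P 1 P, mul_one, hP]
        simp
      have hPu' : P *ᵥ u = 0 := (smul_eq_zero.mp hPu).resolve_left h0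
      have e : Q * P * Q = Q * ((1 - P) * (1 - Q)) + Q * P := by
        have : Q * ((1 - P) * (1 - Q)) = Q - Q * Q - Q * P + Q * P * Q := by noncomm_ring
        rw [this, hQ]; abel
      rw [Matrix.mulVec_mulVec, e, Matrix.add_mulVec, ← Matrix.mulVec_mulVec u Q ((1 - P) * (1 - Q)),
        ← Matrix.mulVec_mulVec u Q P, h, hPu', Matrix.mulVec_smul]
      simp
  · rintro ⟨v, hv, h⟩
    have hQv : Q *ᵥ v = v := by
      have : r • (Q *ᵥ v) = r • v := by
        rw [← Matrix.mulVec_smul, ← h, Matrix.mulVec_mulVec, ← mul_assoc, hQ]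
      exact smul_right_injective _ h0 this
    refine ⟨(1 - P) *ᵥ v, fun hz => ?_, ?_⟩
    · rw [Matrix.sub_mulVec, Matrix.one_mulVec, sub_eq_zero] at hz
      rw [← Matrix.mulVec_mulVec, ← hz, hQv] at h
      have h2 : (1 - r) • v = 0 := by rw [sub_smul, one_smul, ← h, sub_self]
      exact (smul_eq_zero.mp h2).elim (fun h => h1 (by linarith)) hv
    · have e : (1 - P) * (1 - Q) * (1 - P) = (1 - P) * (1 - Q) + (1 - P) * (Q * P) := by
        have : (1 - P) * (1 - Q) * (1 - P)
            = (1 - P) * (1 - Q) + (1 - P) * (Q * P) - (P - P * P) := by noncomm_ring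
        rw [this, hP]; simp
      rw [Matrix.mulVec_mulVec, e, Matrix.add_mulVec, ← Matrix.mulVec_mulVec,
        ← Matrix.mulVec_mulVec, h, Matrix.sub_mulVec 1 Q, hQv, Matrix.mulVec_smul]
      simp


/-- Let `S̃` be an `n × n` real symmetric positive definite matrix, `P`
an `n × n` real matrix with `P² = P`, and `E = I - P`. Then the spectra of
`G_p = E S̃⁻¹ Eᵀ S̃` and `G_d = Pᵀ S̃ P S̃⁻¹` coincide except possibly for the values
`0` and `1`:  `spectrum(G_p) \ {0, 1} = spectrum(G_d) \ {0, 1}`. -/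
theorem spectra_coincide_except_zero_one {n : ℕ}
    (St : Matrix (Fin n) (Fin n) ℝ) (hSt : St.PosDef)
    (P : Matrix (Fin n) (Fin n) ℝ) (hP : P * P = P) :
    spectrum ℝ ((1 - P) * St⁻¹ * (1 - P)ᵀ * St) \ {0, 1} =
      spectrum ℝ (Pᵀ * St * P * St⁻¹) \ {0, 1} := by
  have hu : IsUnit St := hSt.isUnit
  have hd : IsUnit St.det := (Matrix.isUnit_iff_isUnit_det _).mp hu
  have hi : St⁻¹ * St = 1 := Matrix.nonsing_inv_mul _ hd
  have hi' : St * St⁻¹ = 1 := Matrix.mul_nonsing_inv _ hd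
  have hPt : Pᵀ * Pᵀ = Pᵀ := by rw [← Matrix.transpose_mul, hP]
  have hQ : (St⁻¹ * Pᵀ * St) * (St⁻¹ * Pᵀ * St) = St⁻¹ * Pᵀ * St := by
    calc _ = St⁻¹ * Pᵀ * (St * St⁻¹) * Pᵀ * St := by simp only [mul_assoc]
      _ = St⁻¹ * (Pᵀ * Pᵀ) * St := by rw [hi']; simp only [mul_assoc, one_mul]
      _ = _ := by rw [hPt]
  have e1 : (1 - P) * St⁻¹ * (1 - P)ᵀ * St = (1 - P) * (1 - St⁻¹ * Pᵀ * St) := by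
    rw [Matrix.transpose_sub, Matrix.transpose_one, ← hi]
    simp only [mul_assoc, mul_sub, sub_mul, hi, mul_one, one_mul]
  let U : (Matrix (Fin n) (Fin n) ℝ)ˣ := ⟨St, St⁻¹, hi', hi⟩
  have e2 : Pᵀ * St * P * St⁻¹ = (U : Matrix (Fin n) (Fin n) ℝ) * ((St⁻¹ * Pᵀ * St) * P) *
      ((U⁻¹ : (Matrix (Fin n) (Fin n) ℝ)ˣ) : Matrix (Fin n) (Fin n) ℝ) := by
    change _ = St * ((St⁻¹ * Pᵀ * St) * P) * St⁻¹
    calc _ = (St * St⁻¹) * Pᵀ * St * P * St⁻¹ := by rw [hi', one_mul]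
      _ = _ := by simp only [mul_assoc]
  rw [e2, spectrum.units_conjugate, e1]
  ext r
  simp only [Set.mem_sdiff, Set.mem_insert_iff, Set.mem_singleton_iff, not_or]
  exact and_congr_left fun h => core_aux P _ hP hQ r h.1 h.2
end
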